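/- arXiv:1001.0513 — 2 statements merged into one kernel-verified Lean document; each statement's English description precedes it below -/
import Mathlib

section
/- Let H ∈ (0,1) with H ≠ 1/2, and for t > 0 define k_{H,t} : ℝ → ℝ by k_{H,t}(x) = (max(t − x, 0))^{H − 1/2} − (max(−x, 0))^{H − 1/2}. Then the constant C(H) := 1/(2H) + ∫₀^∞ ((1+u)^{H−1/2} − u^{H−1/2})² du is finite, and for all t, s > 0 one has ∫_ℝ k_{H,t}(x) · k_{H,s}(x) dx = C(H) · (1/2)·(t^{2H} + s^{2H} − |t − s|^{2H}). -/
open MeasureTheory Set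

/-- The Mandelbrot–Van Ness kernel of fractional Brownian motion. -/
noncomputable def mvnKernel (H t x : ℝ) : ℝ :=
  (max (t - x) 0) ^ (H - 1/2) - (max (-x) 0) ^ (H - 1/2)

lemma mvn_diff_bound (a u : ℝ) (ha : a ∈ Ioo (-1/2 : ℝ) (1/2)) (hu : 0 < u) :
    |(1 + u) ^ a - u ^ a| ≤ |a| * u ^ (a - 1) := by
  have h := Convex.norm_image_sub_le_of_norm_hasDerivWithin_le
    (f := fun x : ℝ => x ^ a) (f' := fun x => a * x ^ (a - 1)) (s := Icc u (1 + u))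
    (x := u) (y := 1 + u) (C := |a| * u ^ (a - 1)) ?_ ?_ (convex_Icc _ _) ?_ ?_
  · simpa using h
  · intro x hx
    have hx0 : 0 < x := lt_of_lt_of_le hu hx.1
    exact (Real.hasDerivAt_rpow_const (Or.inl hx0.ne')).hasDerivWithinAt
  · intro x hx
    have hx0 : 0 < x := lt_of_lt_of_le hu hx.1
    rw [Real.norm_eq_abs, abs_mul, abs_of_nonneg (Real.rpow_nonneg hx0.le _)]
    refine mul_le_mul_of_nonneg_left ?_ (abs_nonneg _)
    exact Real.rpow_le_rpow_of_nonpos hu hx.1 (by linarith [ha.2])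
  · exact ⟨le_refl _, by linarith⟩
  · exact ⟨by linarith, le_refl _⟩

lemma mvn_sq_rpow (a u : ℝ) (hu : 0 ≤ u) : (u ^ a) ^ 2 = u ^ (2 * a) := by
  rw [mul_comm, Real.rpow_mul hu]; norm_num

lemma mvn_f_integrable (a : ℝ) (ha : a ∈ Ioo (-1/2 : ℝ) (1/2)) :
    IntegrableOn (fun u : ℝ => ((1 + u) ^ a - u ^ a) ^ 2) (Ioi 0) := by
  have hm : Measurable (fun u : ℝ => ((1 + u) ^ a - u ^ a) ^ 2) := by fun_prop
  rw [← Ioc_union_Ioi_eq_Ioi (zero_le_one (α := ℝ))]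
  refine IntegrableOn.union ?_ ?_
  · have h1 : IntegrableOn (fun u : ℝ => u ^ (2 * a)) (Ioc 0 1) :=
      (intervalIntegrable_iff_integrableOn_Ioc_of_le zero_le_one).1
        (intervalIntegral.intervalIntegrable_rpow' (by linarith [ha.1]))
    have h2 : IntegrableOn (fun u : ℝ => (1 + u) ^ (2 * a)) (Ioc 0 1) := by
      have h := (intervalIntegral.intervalIntegrable_rpow' (r := 2 * a) (a := 1) (b := 2)
        (by linarith [ha.1])).comp_add_left 1
      norm_num at h
      exact (intervalIntegrable_iff_integrableOn_Ioc_of_le zero_le_one).1 h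
    refine ((h2.add h1).const_mul 2).mono' hm.aestronglyMeasurable ?_
    filter_upwards [ae_restrict_mem measurableSet_Ioc] with u hu
    have hu0 := hu.1
    rw [Real.norm_eq_abs, abs_of_nonneg (sq_nonneg _)]
    simp only [Pi.add_apply]
    rw [← mvn_sq_rpow a u hu0.le, ← mvn_sq_rpow a (1 + u) (by linarith)]
    nlinarith [sq_nonneg ((1 + u) ^ a + u ^ a)]
  · have h1 : IntegrableOn (fun u : ℝ => u ^ (2 * (a - 1))) (Ioi 1) :=
      integrableOn_Ioi_rpow_of_lt (by linarith [ha.2]) one_pos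
    refine (h1.const_mul (a ^ 2)).mono' hm.aestronglyMeasurable ?_
    filter_upwards [ae_restrict_mem measurableSet_Ioi] with u hu
    have hu0 : 0 < u := lt_trans one_pos hu
    rw [Real.norm_eq_abs, abs_of_nonneg (sq_nonneg _), ← mvn_sq_rpow _ u hu0.le, ← mul_pow]
    refine sq_le_sq.2 ?_
    refine (mvn_diff_bound a u ha hu0).trans (le_of_eq ?_)
    rw [abs_mul, abs_of_nonneg (Real.rpow_nonneg hu0.le (a - 1))]

lemma mvn_one (H : ℝ) (hH : H ∈ Ioo (0:ℝ) 1) (hne : H ≠ 1/2) :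
    Integrable (fun x => mvnKernel H 1 x ^ 2) ∧ ∫ x, mvnKernel H 1 x ^ 2 =
      1 / (2 * H) + ∫ u in Ioi (0:ℝ), ((1 + u) ^ (H - 1/2) - u ^ (H - 1/2)) ^ 2 := by
  have ha : H - 1/2 ∈ Ioo (-1/2 : ℝ) (1/2) := ⟨by linarith [hH.1], by linarith [hH.2]⟩
  have ha0 : H - 1/2 ≠ 0 := sub_ne_zero.2 hne
  have hf := mvn_f_integrable _ ha
  set f : ℝ → ℝ := fun u : ℝ => ((1 + u) ^ (H - 1/2) - u ^ (H - 1/2)) ^ 2 with hfdef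
  have e1 : EqOn (fun x => f (-x)) (fun x => mvnKernel H 1 x ^ 2) (Iic 0) := by
    intro x hx
    have hx' : x ≤ 0 := hx
    simp only [hfdef, mvnKernel]
    rw [max_eq_left (by linarith), max_eq_left (by linarith)]
    ring_nf
  have e2 : EqOn (fun x : ℝ => (1 - x) ^ (2 * (H - 1/2)))
      (fun x => mvnKernel H 1 x ^ 2) (Ioc 0 1) := by
    intro x hx
    simp only [mvnKernel]
    rw [max_eq_left (by linarith [hx.2]), max_eq_right (by linarith [hx.1]),
      Real.zero_rpow ha0, sub_zero, mvn_sq_rpow _ _ (by linarith [hx.2])]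
  have e3 : EqOn (fun _ : ℝ => (0:ℝ)) (fun x => mvnKernel H 1 x ^ 2) (Ioi 1) := by
    intro x hx
    have hx' : 1 < x := hx
    simp only [mvnKernel]
    rw [max_eq_right (by linarith), max_eq_right (by linarith)]
    simp
  have i1 : IntegrableOn (fun x => mvnKernel H 1 x ^ 2) (Iic 0) := by
    refine IntegrableOn.congr_fun ?_ e1 measurableSet_Iic
    have := (integrableOn_Ici_iff_integrableOn_Ioi).2 hf
    have h := this.comp_neg
    simpa using h
  have ii : IntervalIntegrable (fun x : ℝ => (1 - x) ^ (2 * (H - 1/2))) volume 0 1 := by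
    have h := (intervalIntegral.intervalIntegrable_rpow' (r := 2 * (H - 1/2)) (a := 0) (b := 1)
        (by linarith [ha.1])).comp_sub_left 1
    simp only [sub_zero, sub_self] at h
    exact h.symm
  have i2 : IntegrableOn (fun x => mvnKernel H 1 x ^ 2) (Ioc 0 1) :=
    IntegrableOn.congr_fun ((intervalIntegrable_iff_integrableOn_Ioc_of_le zero_le_one).1 ii)
      e2 measurableSet_Ioc
  have i3 : IntegrableOn (fun x => mvnKernel H 1 x ^ 2) (Ioi 1) :=
    IntegrableOn.congr_fun integrableOn_zero e3 measurableSet_Ioi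
  have i23 : IntegrableOn (fun x => mvnKernel H 1 x ^ 2) (Ioi 0) := by
    rw [← Ioc_union_Ioi_eq_Ioi (zero_le_one (α := ℝ))]
    exact i2.union i3
  refine ⟨?_, ?_⟩
  · rw [← integrableOn_univ, ← Iic_union_Ioi (a := (0:ℝ))]
    exact i1.union i23
  · rw [← intervalIntegral.integral_Iic_add_Ioi i1 i23,
      ← Ioc_union_Ioi_eq_Ioi (zero_le_one (α := ℝ)),
      setIntegral_union (Ioc_disjoint_Ioi le_rfl) measurableSet_Ioi i2 i3,
      ← setIntegral_congr_fun measurableSet_Iic e1, ← setIntegral_congr_fun measurableSet_Ioc e2,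
      ← setIntegral_congr_fun measurableSet_Ioi e3, integral_comp_neg_Iic,
      ← intervalIntegral.integral_of_le zero_le_one,
      intervalIntegral.integral_comp_sub_left (fun x : ℝ => x ^ (2 * (H - 1/2))) 1,
      integral_rpow (Or.inl (by linarith [ha.1])), Ioc_union_Ioi_eq_Ioi zero_le_one]
    have h2 : 2 * (H - 1/2) + 1 = 2 * H := by ring
    have h3 : 2 * H ≠ 0 := by linarith [hH.1]
    rw [h2]
    simp [Real.zero_rpow h3]
    ring

lemma mvn_scale (H t x : ℝ) (ht : 0 < t) :
    mvnKernel H t x = t ^ (H - 1/2) * mvnKernel H 1 (t⁻¹ * x) := by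
  simp only [mvnKernel]
  have h1 : max (t - x) 0 = t * max (1 - t⁻¹ * x) 0 := by
    rw [mul_max_of_nonneg _ _ ht.le]; congr 1 <;> field_simp <;> simp
  have h2 : max (-x) 0 = t * max (-(t⁻¹ * x)) 0 := by
    rw [mul_max_of_nonneg _ _ ht.le]; congr 1 <;> field_simp <;> simp
  rw [h1, h2, Real.mul_rpow ht.le (le_max_right _ _), Real.mul_rpow ht.le (le_max_right _ _)]
  ring

lemma mvn_t (H : ℝ) (hH : H ∈ Ioo (0:ℝ) 1) (hne : H ≠ 1/2) (t : ℝ) (ht : 0 < t) :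
    Integrable (fun x => mvnKernel H t x ^ 2) ∧ ∫ x, mvnKernel H t x ^ 2 =
      (1 / (2 * H) + ∫ u in Ioi (0:ℝ), ((1 + u) ^ (H - 1/2) - u ^ (H - 1/2)) ^ 2)
        * t ^ (2 * H) := by
  obtain ⟨h1, h2⟩ := mvn_one H hH hne
  simp_rw [mvn_scale H t _ ht, mul_pow, mvn_sq_rpow _ t ht.le]
  refine ⟨(h1.comp_mul_left' (inv_ne_zero ht.ne')).const_mul _, ?_⟩
  rw [integral_const_mul, Measure.integral_comp_mul_left (fun x => mvnKernel H 1 x ^ 2), h2]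
  have : t ^ (2 * H) = t ^ (2 * (H - 1/2)) * t := by
    rw [← Real.rpow_add_one ht.ne']; ring_nf
  rw [this, inv_inv, abs_of_pos ht, smul_eq_mul]
  ring

lemma mvn_diff (H : ℝ) (hH : H ∈ Ioo (0:ℝ) 1) (hne : H ≠ 1/2) (t s : ℝ) (hts : s ≤ t) :
    Integrable (fun x => (mvnKernel H t x - mvnKernel H s x) ^ 2) ∧
    ∫ x, (mvnKernel H t x - mvnKernel H s x) ^ 2 =
      (1 / (2 * H) + ∫ u in Ioi (0:ℝ), ((1 + u) ^ (H - 1/2) - u ^ (H - 1/2)) ^ 2)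
        * |t - s| ^ (2 * H) := by
  rcases hts.eq_or_lt with rfl | h
  · have h3 : 2 * H ≠ 0 := by linarith [hH.1]
    simp [Real.zero_rpow h3]
  · have key : ∀ x, mvnKernel H t x - mvnKernel H s x = mvnKernel H (t - s) (x - s) := by
      intro x
      simp only [mvnKernel]
      rw [show t - s - (x - s) = t - x by ring, show -(x - s) = s - x by ring]
      ring
    simp_rw [key]
    obtain ⟨h1, h2⟩ := mvn_t H hH hne (t - s) (sub_pos.2 h)
    refine ⟨h1.comp_sub_right s, ?_⟩
    rw [integral_sub_right_eq_self (fun x => mvnKernel H (t - s) x ^ 2), h2,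
      abs_of_pos (sub_pos.2 h)]

/-- For `H ∈ (0,1)`, `H ≠ 1/2`, the constant
`C(H) = 1/(2H) + ∫₀^∞ ((1+u)^{H-1/2} - u^{H-1/2})² du` is finite, and for `t, s > 0`,
`∫_ℝ k_{H,t}(x) k_{H,s}(x) dx = C(H) · (1/2)(t^{2H} + s^{2H} - |t-s|^{2H})`. -/
theorem mvnKernel_inner (H : ℝ) (hH : H ∈ Ioo (0:ℝ) 1) (hne : H ≠ 1/2) :
    IntegrableOn (fun u : ℝ => ((1 + u) ^ (H - 1/2) - u ^ (H - 1/2)) ^ 2) (Ioi 0) ∧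
      ∀ t s : ℝ, 0 < t → 0 < s →
        ∫ x : ℝ, mvnKernel H t x * mvnKernel H s x =
          (1 / (2 * H) + ∫ u in Ioi (0:ℝ), ((1 + u) ^ (H - 1/2) - u ^ (H - 1/2)) ^ 2) *
            (1 / 2 * (t ^ (2 * H) + s ^ (2 * H) - |t - s| ^ (2 * H))) := by
  refine ⟨mvn_f_integrable _ ⟨by linarith [hH.1], by linarith [hH.2]⟩, ?_⟩
  intro t s ht hs
  obtain ⟨a1, a2⟩ := mvn_t H hH hne t ht
  obtain ⟨b1, b2⟩ := mvn_t H hH hne s hs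
  have hc : Integrable (fun x => (mvnKernel H t x - mvnKernel H s x) ^ 2) ∧
      ∫ x, (mvnKernel H t x - mvnKernel H s x) ^ 2 =
      (1 / (2 * H) + ∫ u in Ioi (0:ℝ), ((1 + u) ^ (H - 1/2) - u ^ (H - 1/2)) ^ 2)
        * |t - s| ^ (2 * H) := by
    rcases le_total s t with h | h
    · exact mvn_diff H hH hne t s h
    · have := mvn_diff H hH hne s t h
      rw [abs_sub_comm t s]
      simp_rw [sub_sq_comm (mvnKernel H t _) (mvnKernel H s _)]
      exact this
  obtain ⟨c1, c2⟩ := hc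
  have key : ∀ x, mvnKernel H t x * mvnKernel H s x = 1 / 2 * (mvnKernel H t x ^ 2
      + mvnKernel H s x ^ 2 - (mvnKernel H t x - mvnKernel H s x) ^ 2) := by
    intro x; ring
  have hab : Integrable (fun x => mvnKernel H t x ^ 2 + mvnKernel H s x ^ 2) := a1.add b1
  simp_rw [key]
  rw [integral_const_mul, integral_sub hab c1, integral_add a1 b1, a2, b2, c2]
  ring
end

section
/- Let H ∈ (0,1) with H ≠ 1/2. There exists a constant C ≥ 0, depending only on H, such that for every Schwartz function f : ℝ → ℝ and every t > 0, |∫_ℝ f(x)·k_{H,t}(x) dx| ≤ C · t · ( sup_{x∈ℝ}|f(x)| + sup_{x∈ℝ}|f'(x)| + ‖f‖_{L²(ℝ)} ). -/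
open MeasureTheory Set

lemma mvn_aux_decay (g : SchwartzMap ℝ ℝ) : ∃ K : ℝ, 0 ≤ K ∧ ∀ x, |g x| ≤ K / (1 + x ^ 2) := by
  obtain ⟨C0, h0, hC0⟩ := g.decay 0 0
  obtain ⟨C2, h2, hC2⟩ := g.decay 2 0
  refine ⟨C0 + C2, by positivity, fun x => ?_⟩
  have a0 := hC0 x
  have a2 := hC2 x
  simp only [norm_iteratedFDeriv_zero, Real.norm_eq_abs, pow_zero, one_mul, sq_abs] at a0 a2
  rw [le_div_iff₀ (by positivity)]
  nlinarith

lemma mvn_aux_decay_shift (g : SchwartzMap ℝ ℝ) (S : ℝ) :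
    ∃ K : ℝ, 0 ≤ K ∧ ∀ s u : ℝ, |s| ≤ S → |g (s - u)| ≤ K / (1 + u ^ 2) := by
  obtain ⟨K, hK, h⟩ := mvn_aux_decay g
  refine ⟨K * (2 * (1 + S ^ 2)), by positivity, fun s u hs => (h _).trans ?_⟩
  have hs2 : s ^ 2 ≤ S ^ 2 := sq_le_sq' (by linarith [(abs_le.1 hs).1]) (abs_le.1 hs).2
  rw [div_le_div_iff₀ (by positivity) (by positivity), mul_assoc]
  refine mul_le_mul_of_nonneg_left ?_ hK
  nlinarith [sq_nonneg (u - 2 * s), mul_nonneg (sq_nonneg S) (sq_nonneg (s - u))]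

lemma mvn_aux_int {a : ℝ} (ha : -1 < a) (ha' : a < 1) :
    IntegrableOn (fun u : ℝ => (1 / (1 + u ^ 2)) * u ^ a) (Ioi 0) := by
  have hm : Measurable (fun u : ℝ => (1 / (1 + u ^ 2)) * u ^ a) := by fun_prop
  rw [← Ioc_union_Ioi_eq_Ioi (zero_le_one' ℝ)]
  refine IntegrableOn.union ?_ ?_
  · have h := (intervalIntegral.intervalIntegrable_rpow' (a := 0) (b := 1) ha)
    rw [intervalIntegrable_iff_integrableOn_Ioc_of_le zero_le_one] at h
    refine Integrable.mono' h hm.aestronglyMeasurable ?_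
    refine (ae_restrict_iff' measurableSet_Ioc).2 (ae_of_all _ fun u hu => ?_)
    have : 0 ≤ u ^ a := Real.rpow_nonneg hu.1.le _
    rw [Real.norm_of_nonneg (by positivity)]
    refine mul_le_of_le_one_left this ?_
    rw [div_le_one (by positivity)]
    nlinarith [sq_nonneg u]
  · have h := integrableOn_Ioi_rpow_of_lt (a := a - 2) (c := 1) (by linarith) one_pos
    refine Integrable.mono' h hm.aestronglyMeasurable ?_
    refine (ae_restrict_iff' measurableSet_Ioi).2 (ae_of_all _ fun u hu => ?_)
    have hu0 : 0 < u := lt_trans one_pos hu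
    have : 0 ≤ u ^ a := Real.rpow_nonneg hu0.le _
    rw [Real.norm_of_nonneg (by positivity), Real.rpow_sub hu0, Real.rpow_two, one_div_mul_eq_div]
    gcongr
    linarith

lemma mvn_aux_int_shift {a : ℝ} (ha : -1 < a) (ha' : a < 1) (g : SchwartzMap ℝ ℝ) (s : ℝ) :
    IntegrableOn (fun u : ℝ => g (s - u) * u ^ a) (Ioi 0) := by
  obtain ⟨K, hK, h⟩ := mvn_aux_decay_shift g |s|
  have hm : Measurable (fun u : ℝ => g (s - u) * u ^ a) := by
    have := g.continuous.measurable
    fun_prop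
  refine Integrable.mono' ((mvn_aux_int ha ha').const_mul K) hm.aestronglyMeasurable ?_
  refine (ae_restrict_iff' measurableSet_Ioi).2 (ae_of_all _ fun u hu => ?_)
  have : 0 ≤ u ^ a := Real.rpow_nonneg (le_of_lt hu) _
  rw [norm_mul, Real.norm_of_nonneg this, ← mul_assoc, mul_one_div]
  exact mul_le_mul_of_nonneg_right (h s u le_rfl) this

lemma mvn_aux_deriv {a : ℝ} (ha : -1 < a) (ha' : a < 1) (f : SchwartzMap ℝ ℝ) (s : ℝ) :
    HasDerivAt (fun s => ∫ u in Ioi (0:ℝ), f (s - u) * u ^ a)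
      (∫ u in Ioi (0:ℝ), SchwartzMap.derivCLM ℝ ℝ f (s - u) * u ^ a) s := by
  set g := SchwartzMap.derivCLM ℝ ℝ f with hg
  obtain ⟨K, hK, h⟩ := mvn_aux_decay_shift g (|s| + 1)
  refine (hasDerivAt_integral_of_dominated_loc_of_deriv_le (s := Metric.ball s 1)
    (F := fun s u => f (s - u) * u ^ a) (F' := fun s u => g (s - u) * u ^ a)
    (bound := fun u => K * ((1 / (1 + u ^ 2)) * u ^ a)) (Metric.ball_mem_nhds s one_pos)
    (Filter.Eventually.of_forall fun x => (mvn_aux_int_shift ha ha' f x).aestronglyMeasurable)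
    (mvn_aux_int_shift ha ha' f s) (mvn_aux_int_shift ha ha' g s).aestronglyMeasurable
    ?_ ((mvn_aux_int ha ha').const_mul K) ?_).2
  · refine (ae_restrict_iff' measurableSet_Ioi).2 (ae_of_all _ fun u hu x hx => ?_)
    have : 0 ≤ u ^ a := Real.rpow_nonneg (le_of_lt hu) _
    rw [norm_mul, Real.norm_of_nonneg this, ← mul_assoc, mul_one_div]
    refine mul_le_mul_of_nonneg_right (h x u ?_) this
    rw [Metric.mem_ball, Real.dist_eq] at hx
    have := abs_sub_abs_le_abs_sub x s
    linarith
  · refine ae_of_all _ fun u x _ => ?_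
    have hd : HasDerivAt f (g (x - u)) (x - u) := by
      rw [hg, SchwartzMap.derivCLM_apply]
      exact f.differentiableAt.hasDerivAt
    exact (hd.comp_sub_const x u).mul_const _

lemma mvn_aux_parts {a : ℝ} (ha : -1 < a) (ha' : a < 1) (f : SchwartzMap ℝ ℝ) (s : ℝ) :
    ∫ u in Ioi (1:ℝ), SchwartzMap.derivCLM ℝ ℝ f (s - u) * u ^ a =
      f (s - 1) + ∫ u in Ioi (1:ℝ), f (s - u) * (a * u ^ (a - 1)) := by
  set g := SchwartzMap.derivCLM ℝ ℝ f with hg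
  have hsub : Ioi (1:ℝ) ⊆ Ioi 0 := Ioi_subset_Ioi zero_le_one
  have hdf : ∀ x, HasDerivAt (fun u => f (s - u)) (-g (s - x)) x := fun x => by
    have hd : HasDerivAt f (g (s - x)) (s - x) := by
      rw [hg, SchwartzMap.derivCLM_apply]
      exact f.differentiableAt.hasDerivAt
    exact hd.comp_const_sub s x
  have hdv : ∀ x ∈ Ioi (1:ℝ), HasDerivAt (fun u : ℝ => u ^ a) (a * x ^ (a - 1)) x := fun x hx =>
    Real.hasDerivAt_rpow_const (Or.inl (lt_trans one_pos hx).ne')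
  have I1 : IntegrableOn (fun u : ℝ => f (s - u) * (a * u ^ (a - 1))) (Ioi 1) := by
    have h0 := ((mvn_aux_int_shift ha ha' f s).mono_set hsub).const_mul a
    have hm : Measurable (fun u : ℝ => f (s - u) * (a * u ^ (a - 1))) := by
      have := f.continuous.measurable
      fun_prop
    refine Integrable.mono h0 hm.aestronglyMeasurable ?_
    refine (ae_restrict_iff' measurableSet_Ioi).2 (ae_of_all _ fun u hu => ?_)
    have hu1 : (1:ℝ) < u := hu
    have hu0 : (0:ℝ) < u := by linarith
    have h1 : u ^ (a - 1) ≤ u ^ a := Real.rpow_le_rpow_of_exponent_le hu1.le (by linarith)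
    have h2 : 0 ≤ u ^ (a - 1) := Real.rpow_nonneg hu0.le _
    rw [norm_mul, norm_mul, norm_mul, norm_mul, Real.norm_of_nonneg h2,
      Real.norm_of_nonneg (h2.trans h1), mul_left_comm]
    gcongr
  have I2 : IntegrableOn (fun u : ℝ => -g (s - u) * u ^ a) (Ioi 1) := by
    simpa using ((mvn_aux_int_shift ha ha' g s).mono_set hsub).neg
  have T1 : Filter.Tendsto (fun u => f (s - u) * u ^ a) (nhdsWithin 1 (Ioi 1))
      (nhds (f (s - 1))) := by
    have hc : ContinuousAt (fun u : ℝ => f (s - u) * u ^ a) 1 := by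
      refine ContinuousAt.mul (hdf 1).continuousAt ?_
      exact Real.continuousAt_rpow_const _ _ (Or.inl one_ne_zero)
    have := hc.tendsto.mono_left (nhdsWithin_le_nhds (s := Ioi 1))
    simpa using this
  have T2 : Filter.Tendsto (fun u => f (s - u) * u ^ a) Filter.atTop (nhds 0) := by
    obtain ⟨K, hK, h⟩ := mvn_aux_decay_shift f |s|
    have ht : Filter.Tendsto (fun u : ℝ => K * u ^ (-(2 - a))) Filter.atTop (nhds 0) := by
      simpa using (tendsto_rpow_neg_atTop (y := 2 - a) (by linarith)).const_mul K
    refine squeeze_zero_norm' ?_ ht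
    filter_upwards [Filter.eventually_gt_atTop 0] with u hu
    have : 0 ≤ u ^ a := Real.rpow_nonneg hu.le _
    rw [norm_mul, Real.norm_of_nonneg this, neg_sub, Real.rpow_sub hu, Real.rpow_two]
    calc ‖f (s - u)‖ * u ^ a ≤ K / (1 + u ^ 2) * u ^ a :=
          mul_le_mul_of_nonneg_right (h s u le_rfl) this
      _ ≤ K / (u ^ 2) * u ^ a := by gcongr; linarith
      _ = _ := by ring
  have key := integral_Ioi_mul_deriv_eq_deriv_mul (u := fun u => f (s - u)) (v := fun u : ℝ => u ^ a)
    (u' := fun u => -g (s - u)) (v' := fun u => a * u ^ (a - 1)) (fun x _ => hdf x) hdv I1 I2 T1 T2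
  have e : ∫ u in Ioi (1:ℝ), -g (s - u) * u ^ a = - ∫ u in Ioi (1:ℝ), g (s - u) * u ^ a := by
    rw [← integral_neg]; simp
  rw [e] at key
  linarith

lemma mvn_aux_cs {a : ℝ} (ha' : a < 1/2) (f : SchwartzMap ℝ ℝ) (s : ℝ) :
    |∫ u in Ioi (1:ℝ), f (s - u) * (a * u ^ (a - 1))| ≤
      |a| * (∫ u in Ioi (1:ℝ), ‖u ^ (a - 1)‖ ^ (2:ℝ)) ^ (1 / 2 : ℝ) *
        (eLpNorm (fun x : ℝ => f x) 2 volume).toReal := by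
  have hf2 : MemLp f 2 volume := f.memLp 2
  have hfs : MemLp (fun u => f (s - u)) 2 volume :=
    hf2.comp_measurePreserving (Measure.measurePreserving_sub_left volume s)
  have hv : MemLp (fun u : ℝ => u ^ (a - 1)) 2 (volume.restrict (Ioi 1)) := by
    have hm : Measurable (fun u : ℝ => u ^ (a - 1)) := by fun_prop
    rw [memLp_two_iff_integrable_sq hm.aestronglyMeasurable]
    refine (integrableOn_Ioi_rpow_of_lt (a := 2 * a - 2) (c := 1) (by linarith) one_pos).congr_fun
      (fun u hu => ?_) measurableSet_Ioi
    have hu0 : (0:ℝ) < u := lt_trans one_pos hu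
    simp only []
    rw [← Real.rpow_natCast, ← Real.rpow_mul hu0.le]
    congr 1
    push_cast
    ring
  have hN : (eLpNorm (fun x : ℝ => f x) 2 volume).toReal = (∫ x, ‖f x‖ ^ (2:ℝ)) ^ (1 / 2 : ℝ) := by
    rw [hf2.eLpNorm_eq_integral_rpow_norm (by norm_num) (by norm_num),
      ENNReal.toReal_ofReal (by positivity)]
    norm_num
  have hol := integral_mul_norm_le_Lp_mul_Lq (μ := volume.restrict (Ioi (1:ℝ)))
    (p := 2) (q := 2) (f := fun u => f (s - u)) (g := fun u : ℝ => u ^ (a - 1))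
    Real.HolderConjugate.two_two (by simpa using hfs.restrict _) (by simpa using hv)
  have hmono : ∫ u in Ioi (1:ℝ), ‖f (s - u)‖ ^ (2:ℝ) ≤ ∫ x, ‖f x‖ ^ (2:ℝ) := by
    rw [← integral_sub_left_eq_self (fun x => ‖f x‖ ^ (2:ℝ)) volume s]
    refine setIntegral_le_integral ?_ (ae_of_all _ fun x => by positivity)
    simpa using hfs.integrable_norm_rpow (by norm_num) (by norm_num)
  have e : ∫ u in Ioi (1:ℝ), f (s - u) * (a * u ^ (a - 1)) =
      a * ∫ u in Ioi (1:ℝ), f (s - u) * u ^ (a - 1) := by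
    rw [← integral_const_mul]
    congr 1
    ext u
    ring
  rw [e, abs_mul, mul_assoc]
  refine mul_le_mul_of_nonneg_left ?_ (abs_nonneg a)
  have h1 : |∫ u in Ioi (1:ℝ), f (s - u) * u ^ (a - 1)| ≤
      ∫ u in Ioi (1:ℝ), ‖f (s - u)‖ * ‖u ^ (a - 1)‖ := by
    simpa only [norm_mul, ← Real.norm_eq_abs] using
      norm_integral_le_integral_norm (μ := volume.restrict (Ioi (1:ℝ)))
        (fun u : ℝ => f (s - u) * u ^ (a - 1))
  rw [hN, mul_comm]
  refine h1.trans (hol.trans ?_)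
  refine mul_le_mul_of_nonneg_right ?_ (Real.rpow_nonneg (integral_nonneg fun _ => by positivity) _)
  exact Real.rpow_le_rpow (integral_nonneg fun _ => by positivity) hmono (by norm_num)

lemma mvn_aux_bdd (g : SchwartzMap ℝ ℝ) : BddAbove (range fun x => |g x|) := by
  obtain ⟨C0, h0, hC0⟩ := g.decay 0 0
  refine ⟨C0, ?_⟩
  rintro _ ⟨x, rfl⟩
  simpa using hC0 x

lemma mvn_aux_deriv_bound {a : ℝ} (ha : -1 < a) (ha' : a < 1/2) (f : SchwartzMap ℝ ℝ) (s : ℝ) :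
    |∫ u in Ioi (0:ℝ), SchwartzMap.derivCLM ℝ ℝ f (s - u) * u ^ a| ≤
      (∫ u in Ioc (0:ℝ) 1, u ^ a) * (⨆ x : ℝ, |deriv (fun y : ℝ => f y) x|) +
      ((⨆ x : ℝ, |f x|) + |a| * (∫ u in Ioi (1:ℝ), ‖u ^ (a - 1)‖ ^ (2:ℝ)) ^ (1 / 2 : ℝ) *
        (eLpNorm (fun x : ℝ => f x) 2 volume).toReal) := by
  have ha1 : a < 1 := by linarith
  have hi := mvn_aux_int_shift ha ha1 (SchwartzMap.derivCLM ℝ ℝ f) s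
  rw [← Ioc_union_Ioi_eq_Ioi (zero_le_one' ℝ)] at hi ⊢
  rw [setIntegral_union (Ioc_disjoint_Ioi le_rfl) measurableSet_Ioi
    (hi.mono_set subset_union_left) (hi.mono_set subset_union_right), mvn_aux_parts ha ha1]
  refine (abs_add_le _ _).trans (add_le_add ?_ ((abs_add_le _ _).trans (add_le_add ?_ ?_)))
  · rw [← integral_mul_const]
    have h := (intervalIntegral.intervalIntegrable_rpow' (a := 0) (b := 1) ha)
    rw [intervalIntegrable_iff_integrableOn_Ioc_of_le zero_le_one] at h
    rw [← Real.norm_eq_abs]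
    refine norm_integral_le_of_norm_le (h.mul_const _) ?_
    refine (ae_restrict_iff' measurableSet_Ioc).2 (ae_of_all _ fun u hu => ?_)
    have : 0 ≤ u ^ a := Real.rpow_nonneg hu.1.le _
    rw [norm_mul, Real.norm_of_nonneg this, mul_comm]
    refine mul_le_mul_of_nonneg_left ?_ this
    have hb := mvn_aux_bdd (SchwartzMap.derivCLM ℝ ℝ f)
    simp only [SchwartzMap.derivCLM_apply] at hb
    rw [SchwartzMap.derivCLM_apply]
    exact le_ciSup hb (s - u)
  · exact le_ciSup (mvn_aux_bdd f) (s - 1)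
  · exact mvn_aux_cs ha' f s

lemma mvn_aux_ind {a : ℝ} (ha0 : a ≠ 0) (f : SchwartzMap ℝ ℝ) (s : ℝ) :
    (fun u : ℝ => f (s - u) * (max u 0) ^ a) =
      (Ioi (0:ℝ)).indicator (fun u => f (s - u) * u ^ a) := by
  ext u
  by_cases hu : 0 < u
  · rw [indicator_of_mem (show u ∈ Ioi (0:ℝ) from hu), max_eq_left hu.le]
  · rw [indicator_of_notMem (show u ∉ Ioi (0:ℝ) from hu), max_eq_right (not_lt.1 hu),
      Real.zero_rpow ha0, mul_zero]

lemma mvn_aux_shift {a : ℝ} (ha : -1 < a) (ha' : a < 1) (ha0 : a ≠ 0) (f : SchwartzMap ℝ ℝ)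
    (s : ℝ) : Integrable (fun x : ℝ => f x * (max (s - x) 0) ^ a) ∧
      ∫ x : ℝ, f x * (max (s - x) 0) ^ a = ∫ u in Ioi (0:ℝ), f (s - u) * u ^ a := by
  have e := mvn_aux_ind ha0 f s
  have hi : Integrable (fun u : ℝ => f (s - u) * (max u 0) ^ a) := by
    rw [e, integrable_indicator_iff measurableSet_Ioi]
    exact mvn_aux_int_shift ha ha' f s
  constructor
  · simpa using hi.comp_sub_left s
  · rw [← integral_indicator measurableSet_Ioi, ← e,
      ← integral_sub_left_eq_self (fun u : ℝ => f (s - u) * (max u 0) ^ a) volume s]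
    simp

/-- For `H ∈ (0,1)`, `H ≠ 1/2`, there is `C ≥ 0` (depending only on `H`) such that for every
Schwartz function `f` and `t > 0`,
`|∫ f(x) k_{H,t}(x) dx| ≤ C t (sup |f| + sup |f'| + ‖f‖_{L²})`. -/
theorem mvnKernel_pairing_bound (H : ℝ) (hH : H ∈ Ioo (0:ℝ) 1) (hne : H ≠ 1/2) :
    ∃ C : ℝ, 0 ≤ C ∧ ∀ (f : SchwartzMap ℝ ℝ) (t : ℝ), 0 < t →
      |∫ x : ℝ, f x * mvnKernel H t x| ≤
        C * t * ((⨆ x : ℝ, |f x|) + (⨆ x : ℝ, |deriv (fun y : ℝ => f y) x|) +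
          (eLpNorm (fun x : ℝ => f x) 2 volume).toReal) := by
  obtain ⟨h0, h1⟩ := hH
  set a : ℝ := H - 1/2 with ha_def
  have ha : -1 < a := by linarith
  have ha2 : a < 1/2 := by linarith
  have ha1 : a < 1 := by linarith
  have ha0 : a ≠ 0 := sub_ne_zero.2 hne
  set A := ∫ u in Ioc (0:ℝ) 1, u ^ a with hA
  set B := |a| * (∫ u in Ioi (1:ℝ), ‖u ^ (a - 1)‖ ^ (2:ℝ)) ^ (1 / 2 : ℝ) with hB
  have hA0 : 0 ≤ A := setIntegral_nonneg measurableSet_Ioc fun u hu => Real.rpow_nonneg hu.1.le _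
  have hB0 : 0 ≤ B := mul_nonneg (abs_nonneg _)
    (Real.rpow_nonneg (integral_nonneg fun _ => by positivity) _)
  refine ⟨A + 1 + B, by positivity, fun f t ht => ?_⟩
  obtain ⟨it, et⟩ := mvn_aux_shift ha ha1 ha0 f t
  obtain ⟨iz, ez⟩ := mvn_aux_shift ha ha1 ha0 f 0
  have e : ∫ x : ℝ, f x * mvnKernel H t x = (∫ u in Ioi (0:ℝ), f (t - u) * u ^ a) -
      ∫ u in Ioi (0:ℝ), f (0 - u) * u ^ a := by
    rw [← et, ← ez, ← integral_sub it iz]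
    simp only [mvnKernel, ← ha_def, mul_sub, zero_sub]
  set P := ⨆ x : ℝ, |f x|
  set Q := ⨆ x : ℝ, |deriv (fun y : ℝ => f y) x|
  set R := (eLpNorm (fun x : ℝ => f x) 2 volume).toReal
  have hP : 0 ≤ P := Real.iSup_nonneg fun _ => abs_nonneg _
  have hQ : 0 ≤ Q := Real.iSup_nonneg fun _ => abs_nonneg _
  have hR : 0 ≤ R := ENNReal.toReal_nonneg
  have mvt := convex_univ.norm_image_sub_le_of_norm_hasDerivWithin_le (𝕜 := ℝ)
    (f := fun s => ∫ u in Ioi (0:ℝ), f (s - u) * u ^ a) (C := A * Q + (P + B * R))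
    (fun s _ => (mvn_aux_deriv ha ha1 f s).hasDerivWithinAt)
    (fun s _ => mvn_aux_deriv_bound ha ha2 f s) (mem_univ 0) (mem_univ t)
  rw [e]
  refine (show _ ≤ (A * Q + (P + B * R)) * ‖t - 0‖ from mvt).trans ?_
  rw [sub_zero, Real.norm_of_nonneg ht.le, mul_right_comm (A + 1 + B)]
  refine mul_le_mul_of_nonneg_right ?_ ht.le
  nlinarith [mul_nonneg hA0 hP, mul_nonneg hA0 hR, mul_nonneg hB0 hP, mul_nonneg hB0 hQ]
end
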